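/- arXiv:1810.06140 — 3 statements merged into one kernel-verified Lean document; each statement's English description precedes it below -/
import Mathlib

section
/- Let (K^{i,j}, d, d') be a double complex of R-modules satisfying the dd'-lemma. If an element α ∈ K^{p,q} satisfies dα = 0, then there exists β ∈ K^{p,q-1} such that d'(α − dβ) = 0. In particular every d-cohomology class in bidegree (p,q) admits a representative that is simultaneously d-closed and d'-closed. (This is the surjectivity part of Proposition: the map H^{p,q}(K_{d'}, d) → H^{p,q}(K, d) induced by the inclusion K_{d'} ↪ K is surjective, stated at the level of elements.) -/
/-- Let `(K^{i,j}, d, d')` be a double complex of `R`-modules satisfying the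
`dd'`-lemma.  If an element `α ∈ K^{p,q}` satisfies `dα = 0`, then there exists
`β ∈ K^{p,q-1}` such that `d'(α - dβ) = 0`; in particular every `d`-cohomology class in
bidegree `(p,q)` admits a representative which is simultaneously `d`-closed and `d'`-closed.
(Here the bidegree `(p,q)` of the statement is written as `(p, q+1)`.)

The double complex is encoded as a family of `R`-modules `K i j` together with a vertical
differential `d : K i j →ₗ[R] K i (j+1)` and a horizontal differential
`d' : K i j →ₗ[R] K (i+1) j` satisfying `d ∘ d = 0`, `d' ∘ d' = 0` and `d d' + d' d = 0`.
The `dd'`-lemma is the condition that in every bidegree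
`ker d ∩ im d' = im (d ∘ d')` and `ker d' ∩ im d = im (d ∘ d')`. -/
theorem dd_lemma_surjectivity
    {R : Type*} [CommRing R]
    (K : ℤ → ℤ → Type*)
    [∀ i j, AddCommGroup (K i j)] [∀ i j, Module R (K i j)]
    (d : ∀ i j, K i j →ₗ[R] K i (j + 1))
    (d' : ∀ i j, K i j →ₗ[R] K (i + 1) j)
    (hdd : ∀ i j (x : K i j), d i (j + 1) (d i j x) = 0)
    (hd'd' : ∀ i j (x : K i j), d' (i + 1) j (d' i j x) = 0)
    (hanti : ∀ i j (x : K i j), d (i + 1) j (d' i j x) + d' i (j + 1) (d i j x) = 0)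
    (hlem₁ : ∀ i j, LinearMap.ker (d (i + 1) (j + 1)) ⊓ LinearMap.range (d' i (j + 1))
      = LinearMap.range ((d (i + 1) j).comp (d' i j)))
    (hlem₂ : ∀ i j, LinearMap.ker (d' (i + 1) (j + 1)) ⊓ LinearMap.range (d (i + 1) j)
      = LinearMap.range ((d (i + 1) j).comp (d' i j)))
    (p q : ℤ) (α : K p (q + 1)) (hα : d p (q + 1) α = 0) :
    ∃ β : K p q, d' p (q + 1) (α - d p q β) = 0 := by
  have hclosed : d (p + 1) (q + 1) (d' p (q + 1) α) = 0 := by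
    simpa [hα] using hanti p (q + 1) α
  have hmem : d' p (q + 1) α ∈ LinearMap.range ((d (p + 1) q).comp (d' p q)) := by
    rw [← hlem₁]
    exact ⟨hclosed, α, rfl⟩
  obtain ⟨γ, hγ⟩ := hmem
  refine ⟨-γ, ?_⟩
  rw [map_neg, sub_neg_eq_add, map_add, ← hγ]
  exact hanti p q γ
end

section
/- Let (K^{i,j}, d, d') be a double complex of R-modules satisfying the dd'-lemma. Then for every pair (p,q) the R-linear map induced by the inclusion K_{d'} ↪ K from H^{p,q}(K_{d'}, d) = (ker d ∩ ker d' ∩ K^{p,q}) / d(ker d' ∩ K^{p,q-1}) to H^{p,q}(K, d) = (ker d ∩ K^{p,q}) / d(K^{p,q-1}) is an isomorphism of R-modules. -/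
/-- Let `(K^{i,j}, d, d')` be a double complex of `R`-modules satisfying the
`dd'`-lemma.  Then for every pair `(p,q)` the `R`-linear map induced by the inclusion
`K_{d'} ↪ K` from `H^{p,q}(K_{d'}, d) = (ker d ∩ ker d' ∩ K^{p,q}) / d(ker d' ∩ K^{p,q-1})`
to `H^{p,q}(K, d) = (ker d ∩ K^{p,q}) / d(K^{p,q-1})` is an isomorphism of `R`-modules.
(Here the bidegree `(p,q)` of the statement is written as `(p, q+1)`.)

The double complex is encoded as a family of `R`-modules `K i j` together with a vertical
differential `d : K i j →ₗ[R] K i (j+1)` and a horizontal differential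
`d' : K i j →ₗ[R] K (i+1) j` satisfying `d ∘ d = 0`, `d' ∘ d' = 0` and `d d' + d' d = 0`.
The `dd'`-lemma is the condition that in every bidegree
`ker d ∩ im d' = im (d ∘ d')` and `ker d' ∩ im d = im (d ∘ d')`.
The map below is `Submodule.mapQ` applied to the inclusion
`ker d ⊓ ker d' ↪ ker d`; it is the map induced on `d`-cohomology by the inclusion of the
subcomplex `K_{d'} = ker d'` into `K`, and the claim is that it is bijective. -/
theorem dd_lemma_cohomology_iso
    {R : Type*} [CommRing R]
    (K : ℤ → ℤ → Type*)
    [∀ i j, AddCommGroup (K i j)] [∀ i j, Module R (K i j)]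
    (d : ∀ i j, K i j →ₗ[R] K i (j + 1))
    (d' : ∀ i j, K i j →ₗ[R] K (i + 1) j)
    (hdd : ∀ i j (x : K i j), d i (j + 1) (d i j x) = 0)
    (hd'd' : ∀ i j (x : K i j), d' (i + 1) j (d' i j x) = 0)
    (hanti : ∀ i j (x : K i j), d (i + 1) j (d' i j x) + d' i (j + 1) (d i j x) = 0)
    (hlem₁ : ∀ i j, LinearMap.ker (d (i + 1) (j + 1)) ⊓ LinearMap.range (d' i (j + 1))
      = LinearMap.range ((d (i + 1) j).comp (d' i j)))
    (hlem₂ : ∀ i j, LinearMap.ker (d' (i + 1) (j + 1)) ⊓ LinearMap.range (d (i + 1) j)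
      = LinearMap.range ((d (i + 1) j).comp (d' i j)))
    (p q : ℤ) :
    Function.Bijective
      (Submodule.mapQ
        -- boundaries of the subcomplex `K_{d'}`, pulled back to the cocycles
        -- `ker d ⊓ ker d'` of `K_{d'}` in bidegree `(p, q+1)`
        ((Submodule.map (d p q) (LinearMap.ker (d' p q))).comap
          (LinearMap.ker (d p (q + 1)) ⊓ LinearMap.ker (d' p (q + 1))).subtype)
        -- boundaries of `K`, pulled back to the cocycles `ker d` of `K` in bidegree `(p, q+1)`
        ((LinearMap.range (d p q)).comap (LinearMap.ker (d p (q + 1))).subtype)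
        -- the map of cocycles induced by the inclusion `K_{d'} ↪ K`
        (Submodule.inclusion inf_le_left)
        (by
          intro x hx
          obtain ⟨y, -, hy⟩ := hx
          exact ⟨y, hy⟩)) := by
  constructor
  · rw [injective_iff_map_eq_zero]
    intro a ha
    obtain ⟨⟨x, hx, hx'⟩, rfl⟩ := Submodule.Quotient.mk_surjective _ a
    rw [Submodule.mapQ_apply, Submodule.Quotient.mk_eq_zero] at ha
    rw [Submodule.Quotient.mk_eq_zero]
    obtain ⟨i, rfl⟩ : ∃ i, p = i + 1 := ⟨p - 1, by ring⟩
    have hmem : x ∈ LinearMap.range ((d (i + 1) q).comp (d' i q)) := by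
      rw [← hlem₂]
      exact ⟨hx', ha⟩
    obtain ⟨z, hz⟩ := hmem
    exact ⟨d' i q z, hd'd' i q z, hz⟩
  · intro b
    obtain ⟨⟨x, hx⟩, rfl⟩ := Submodule.Quotient.mk_surjective _ b
    rw [LinearMap.mem_ker] at hx
    have hmem : d' p (q + 1) x ∈ LinearMap.range ((d (p + 1) q).comp (d' p q)) := by
      rw [← hlem₁]
      refine ⟨?_, x, rfl⟩
      simpa [hx] using hanti p (q + 1) x
    obtain ⟨y, hy⟩ := hmem
    rw [LinearMap.comp_apply] at hy
    refine ⟨Submodule.Quotient.mk ⟨x + d p q y, ?_, ?_⟩, ?_⟩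
    · simp [hx, hdd]
    · simpa [hy] using hanti p q y
    · rw [Submodule.mapQ_apply, Submodule.Quotient.eq]
      exact ⟨y, by simp⟩
end

section
/- Let (K^{i,j}, d, d') be a bounded double complex of R-modules satisfying the dd'-lemma. Let α be an element of the total complex of total degree r, with bihomogeneous components α^{p,q} ∈ K^{p,q} for p+q = r, and suppose Dα = 0 where D = d + d'. Then there exists an element β of the total complex of total degree r−1 such that every bihomogeneous component γ^{p,q} of α − Dβ satisfies d γ^{p,q} = 0 and d' γ^{p,q} = 0. -/
/-- Let `(K^{i,j}, d, d')` be a bounded double complex of `R`-modules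
satisfying the `dd'`-lemma.  Let `α` be an element of the total complex of total degree `r`,
with bihomogeneous components `α^{p,q} ∈ K^{p,q}` for `p + q = r`, and suppose `Dα = 0` where
`D = d + d'`.  Then there exists an element `β` of the total complex of total degree `r - 1`
such that every bihomogeneous component `γ^{p,q}` of `α - Dβ` satisfies `d γ^{p,q} = 0` and
`d' γ^{p,q} = 0`.

The double complex is encoded inside an ambient `R`-module `M` (the underlying module of the
total complex): `K i j` is a family of submodules of `M` which is supremum-independent (so
that the `K i j` form an internal direct sum), `d` and `d'` are endomorphisms of `M` mapping
`K i j` into `K i (j+1)` and `K (i+1) j` respectively, with `d ∘ d = 0`, `d' ∘ d' = 0` and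
`d ∘ d' + d' ∘ d = 0`.  Boundedness says that for each total degree `n` only finitely many
bidegrees `(p, n - p)` carry a nonzero module.  The `dd'`-lemma is the condition that in
every bidegree `ker d ∩ im d' = im (d ∘ d')` and `ker d' ∩ im d = im (d ∘ d')`.  An element
of total degree `r` is recorded by its components `a p ∈ K p (r - p)`; the component of
`Dα` in bidegree `(p, r + 1 - p)` is `d (a p) + d' (a (p - 1))`, and the component of
`α - Dβ` in bidegree `(p, r - p)` is `a p - (d (b p) + d' (b (p - 1)))`. -/
theorem dd_lemma_total_representative
    {R M : Type*} [CommRing R] [AddCommGroup M] [Module R M]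
    (K : ℤ → ℤ → Submodule R M)
    (hindep : iSupIndep (fun pq : ℤ × ℤ => K pq.1 pq.2))
    (hbounded : ∀ n : ℤ, {pq : ℤ × ℤ | pq.1 + pq.2 = n ∧ K pq.1 pq.2 ≠ ⊥}.Finite)
    (d d' : M →ₗ[R] M)
    (hd : ∀ i j, (K i j).map d ≤ K i (j + 1))
    (hd' : ∀ i j, (K i j).map d' ≤ K (i + 1) j)
    (hdd : d ∘ₗ d = 0) (hd'd' : d' ∘ₗ d' = 0)
    (hanti : d ∘ₗ d' + d' ∘ₗ d = 0)
    (hlem₁ : ∀ i j, LinearMap.ker d ⊓ (K (i - 1) j).map d'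
      = ((K (i - 1) (j - 1)).map d').map d)
    (hlem₂ : ∀ i j, LinearMap.ker d' ⊓ (K i (j - 1)).map d
      = ((K (i - 1) (j - 1)).map d').map d)
    (r : ℤ) (a : ℤ → M) (ha : ∀ p, a p ∈ K p (r - p))
    (hDa : ∀ p, d (a p) + d' (a (p - 1)) = 0) :
    ∃ b : ℤ → M, (∀ p, b p ∈ K p (r - 1 - p)) ∧
      ∀ p, d (a p - (d (b p) + d' (b (p - 1)))) = 0 ∧
        d' (a p - (d (b p) + d' (b (p - 1)))) = 0 := by
  have hex : ∀ p, ∃ x ∈ K p (r - 1 - p), d (d' x) = d (a (p + 1)) := by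
    intro p
    have hDp := hDa (p + 1)
    rw [add_sub_cancel_right] at hDp
    have himage : d (a (p + 1)) ∈ LinearMap.ker d ⊓ (K (p + 1 - 1) (r - p)).map d' := by
      refine ⟨LinearMap.congr_fun hdd _, -a p, ?_, ?_⟩
      · rw [add_sub_cancel_right]
        exact neg_mem (ha p)
      · rw [map_neg, eq_neg_of_add_eq_zero_left hDp]
    rw [hlem₁, add_sub_cancel_right, sub_right_comm] at himage
    obtain ⟨_, ⟨x, hx, rfl⟩, hxa⟩ := himage
    exact ⟨x, hx, hxa⟩
  choose b hb hdb using hex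
  refine ⟨b, hb, fun p => ⟨?_, ?_⟩⟩
  · have hdd_b : d (d (b p)) = 0 := LinearMap.congr_fun hdd _
    have hdb_prev := hdb (p - 1)
    rw [sub_add_cancel] at hdb_prev
    rw [map_sub, map_add, hdd_b, hdb_prev, zero_add, sub_self]
  · have hd'd'_b : d' (d' (b (p - 1))) = 0 := LinearMap.congr_fun hd'd' _
    have hanti_b : d (d' (b p)) + d' (d (b p)) = 0 := LinearMap.congr_fun hanti _
    have hDp := hDa (p + 1)
    rw [add_sub_cancel_right, ← hdb p] at hDp
    rw [map_sub, map_add, hd'd'_b, add_zero, sub_eq_zero]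
    exact add_left_cancel (hDp.trans hanti_b.symm)
end
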